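/- arXiv:1907.09805 — 5 statements merged into one kernel-verified Lean document; each statement's English description precedes it below -/
import Mathlib

section
/- Let k ≥ 1 and let t_1, …, t_k be pairwise distinct rational numbers with 0 < t_i < 1 for each i. Consider the degree-one rules Q_0(g) = 2·g(0) and Q_i(g) = g(−t_i) + g(t_i) for i = 1, …, k, and combined rules of the form W(g) = a_0·Q_0(g) + a_1·Q_1(g) + … + a_k·Q_k(g). Then there exist unique real numbers a_0, a_1, …, a_k such that W(φ_j) = I(φ_j) for every j with 0 ≤ j ≤ 2k+1; moreover these weights satisfy a_0 + a_1 + … + a_k = 1 and each a_i is a rational number. -/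
theorem existsUnique_weights_of_moments {K : Type*} [Field K] {n : ℕ} {v : Fin n → K}
    (hv : Function.Injective v) (b : Fin n → K) :
    ∃! a : Fin n → K, ∀ m : Fin n, ∑ i, a i * v i ^ (m : ℕ) = b m := by
  have hu : IsUnit (Matrix.vandermonde v) :=
    (Matrix.isUnit_iff_isUnit_det _).2 (Matrix.det_vandermonde_ne_zero_iff.2 hv).isUnit
  have key (a : Fin n → K) : (∀ m : Fin n, ∑ i, a i * v i ^ (m : ℕ) = b m) ↔
      Matrix.vecMul a (Matrix.vandermonde v) = b := by
    simp [funext_iff, Matrix.vecMul, dotProduct, Matrix.vandermonde_apply]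
  simp only [key]
  exact ((Matrix.vecMul_injective_iff_isUnit.2 hu).existsUnique_of_mem_range
    (Matrix.vecMul_surjective_iff_isUnit.2 hu b))

/-- The squared nodes of the combined rule, the midpoint being the first. -/
def squaredNodes {k : ℕ} (t : Fin k → ℚ) : Fin (k + 1) → ℚ :=
  Fin.cons 0 fun i => t i ^ 2

theorem squaredNodes_injective {k : ℕ} {t : Fin k → ℚ} (hinj : Function.Injective t)
    (hpos : ∀ i, 0 < t i) : Function.Injective (squaredNodes t) := by
  refine Fin.cons_injective_iff.2 ⟨?_, fun i j h => hinj ?_⟩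
  · rintro ⟨i, hi⟩
    exact (pow_pos (hpos i) 2).ne' hi
  · exact (pow_left_inj₀ (hpos i).le (hpos j).le two_ne_zero).1 h

theorem exact_iff_even_moments {k : ℕ} (t : Fin k → ℚ) (a : Fin (k + 1) → ℝ) :
    (∀ j : ℕ, j ≤ 2 * k + 1 →
      a 0 * (2 * (0:ℝ) ^ j) +
        ∑ i : Fin k, a i.succ * ((-(t i : ℝ)) ^ j + (t i : ℝ) ^ j)
        = ∫ x in (-1:ℝ)..1, x ^ j) ↔
    ∀ m : Fin (k + 1),
      ∑ i, a i * (squaredNodes t i : ℝ) ^ (m : ℕ) = ((1 / (2 * (m : ℕ) + 1) : ℚ) : ℝ) := by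
  have even_case (m : ℕ) : (a 0 * (2 * (0:ℝ) ^ (2 * m)) +
        ∑ i : Fin k, a i.succ * ((-(t i : ℝ)) ^ (2 * m) + (t i : ℝ) ^ (2 * m))
        = ∫ x in (-1:ℝ)..1, x ^ (2 * m)) ↔
      ∑ i, a i * (squaredNodes t i : ℝ) ^ m = ((1 / (2 * m + 1) : ℚ) : ℝ) := by
    have hl : a 0 * (2 * (0:ℝ) ^ (2 * m)) +
        ∑ i : Fin k, a i.succ * ((-(t i : ℝ)) ^ (2 * m) + (t i : ℝ) ^ (2 * m)) =
        2 * ∑ i, a i * (squaredNodes t i : ℝ) ^ m := by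
      rw [Fin.sum_univ_succ, mul_add, Finset.mul_sum]
      congr 1
      · simp [squaredNodes, pow_mul]; ring
      · refine Finset.sum_congr rfl fun i _ => ?_
        simp [squaredNodes, pow_mul]; ring
    have hr : ∫ x in (-1:ℝ)..1, x ^ (2 * m) = 2 * ((1 / (2 * m + 1) : ℚ) : ℝ) := by
      rw [integral_pow, Odd.neg_one_pow ⟨m, rfl⟩]
      push_cast
      ring
    rw [hl, hr, mul_right_inj' two_ne_zero]
  constructor
  · intro h m
    exact (even_case m).1 (h _ (by omega))
  · intro h j hj
    obtain ⟨m, rfl | rfl⟩ := j.even_or_odd'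
    · exact (even_case m).2 (h ⟨m, by omega⟩)
    · rw [integral_pow, Even.neg_one_pow ⟨m + 1, by ring⟩]
      simp [Odd.neg_pow ⟨m, rfl⟩]

/-- Given k ≥ 1 distinct rational nodes in (0,1), there exist
unique real weights a_0, …, a_k such that the combined rule
W(g) = a_0·2·g(0) + Σ_i a_i·(g(−t_i) + g(t_i)) is exact on φ_j for
0 ≤ j ≤ 2k+1; these weights sum to 1 and are all rational. -/
theorem combined_open_rule_weights
    (k : ℕ) (hk : 1 ≤ k) (t : Fin k → ℚ)
    (hinj : Function.Injective t)
    (hpos : ∀ i, 0 < t i) (hlt : ∀ i, t i < 1) :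
    (∃! a : Fin (k + 1) → ℝ,
      ∀ j : ℕ, j ≤ 2 * k + 1 →
        a 0 * (2 * (0:ℝ) ^ j) +
          ∑ i : Fin k, a i.succ * ((-(t i : ℝ)) ^ j + (t i : ℝ) ^ j)
          = ∫ x in (-1:ℝ)..1, x ^ j) ∧
    (∀ a : Fin (k + 1) → ℝ,
      (∀ j : ℕ, j ≤ 2 * k + 1 →
        a 0 * (2 * (0:ℝ) ^ j) +
          ∑ i : Fin k, a i.succ * ((-(t i : ℝ)) ^ j + (t i : ℝ) ^ j)
          = ∫ x in (-1:ℝ)..1, x ^ j) →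
      (∑ i, a i = 1) ∧ ∀ i, ∃ q : ℚ, a i = (q : ℝ)) := by
  simp only [exact_iff_even_moments t]
  have hv := squaredNodes_injective hinj hpos
  have hex := existsUnique_weights_of_moments (K := ℝ)
    (v := fun i => (squaredNodes t i : ℝ)) (Rat.cast_injective.comp hv)
    fun m => ((1 / (2 * (m : ℕ) + 1) : ℚ) : ℝ)
  refine ⟨hex, fun a ha => ⟨by simpa using ha 0, ?_⟩⟩
  obtain ⟨q, hq, -⟩ := existsUnique_weights_of_moments hv
    fun m => (1 / (2 * (m : ℕ) + 1) : ℚ)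
  have haq : a = fun i => (q i : ℝ) :=
    hex.unique ha fun m => by simpa using congrArg (Rat.cast : ℚ → ℝ) (hq m)
  exact fun i => ⟨q i, congrFun haq i⟩
end

section
/- Let t_1 and t_2 be distinct rational numbers with 0 < t_1 < 1 and 0 < t_2 < 1. Then there exists a unique triple (a_0, a_1, a_2) ∈ ℝ³ such that the rule W(g) = 2·a_0·g(0) + a_1·(g(−t_1) + g(t_1)) + a_2·(g(−t_2) + g(t_2)) satisfies W(φ_j) = I(φ_j) for j = 0, 1, 2, 3, 4, 5; this triple satisfies a_0 + a_1 + a_2 = 1, each a_i is rational, and W(φ_6) ≠ 2/7 = I(φ_6), so W has degree exactly 5. -/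
/-- Exactness of the symmetric five-node rule up to degree five, as a linear system in its
weights. -/
lemma symmetric_rule_exact_iff (u v a b c : ℝ) :
    (∀ j : ℕ, j ≤ 5 →
      2 * a * (0 : ℝ) ^ j + b * ((-u) ^ j + u ^ j) + c * ((-v) ^ j + v ^ j)
        = ∫ x in (-1 : ℝ)..1, x ^ j) ↔
    a + b + c = 1 ∧ b * u ^ 2 + c * v ^ 2 = 1 / 3 ∧ b * u ^ 4 + c * v ^ 4 = 1 / 5 := by
  constructor
  · intro h
    have h0 := h 0 (by norm_num)
    have h2 := h 2 (by norm_num)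
    have h4 := h 4 (by norm_num)
    rw [integral_pow] at h0 h2 h4
    norm_num at h0 h2 h4
    exact ⟨by linarith, by linarith, by linarith⟩
  · rintro ⟨h0, h2, h4⟩ j hj
    rw [integral_pow]
    interval_cases j <;> norm_num <;> linarith

/-- If `3 ∣ a` with `a / c` and `b / d` in lowest terms, the squares of these fractions cannot
satisfy the exactness equation in degree six; the obstruction is `3`-adic. -/
lemma sq_fractions_ne_of_three_dvd {a b c d : ℤ} (hac : IsCoprime a c) (hbd : IsCoprime b d)
    (ha : 3 ∣ a) : 21 * (a ^ 2 * d ^ 2 + b ^ 2 * c ^ 2) - 35 * a ^ 2 * b ^ 2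
      ≠ 15 * c ^ 2 * d ^ 2 := by
  intro h
  obtain ⟨k, rfl⟩ := ha
  have hc : ¬ (3 : ℤ) ∣ c := fun hc ↦ by
    have := hac.isUnit_of_dvd' (dvd_mul_right 3 k) hc
    norm_num [Int.isUnit_iff] at this
  have hprod : (3 : ℤ) ∣ c ^ 2 * (b ^ 2 + d ^ 2) :=
    ⟨2 * c ^ 2 * d ^ 2 - 2 * b ^ 2 * c ^ 2 - 21 * k ^ 2 * d ^ 2 + 35 * k ^ 2 * b ^ 2, by linarith⟩
  have hsum : (3 : ℤ) ∣ b ^ 2 + d ^ 2 :=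
    (Int.prime_three.dvd_or_dvd hprod).resolve_left fun h' ↦ hc (Int.prime_three.dvd_of_dvd_pow h')
  have hdvd : (3 : ℤ) ∣ b ∧ (3 : ℤ) ∣ d := by
    have hb : b % 3 = 0 ∨ b % 3 = 1 ∨ b % 3 = 2 := by omega
    have hd : d % 3 = 0 ∨ d % 3 = 1 ∨ d % 3 = 2 := by omega
    have hmod := Int.emod_eq_zero_of_dvd hsum
    rcases hb with hb | hb | hb <;> rcases hd with hd | hd | hd <;>
      simp [pow_two, Int.add_emod, Int.mul_emod, hb, hd] at hmod
    exact ⟨Int.dvd_of_emod_eq_zero hb, Int.dvd_of_emod_eq_zero hd⟩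
  have := hbd.isUnit_of_dvd' hdvd.1 hdvd.2
  norm_num [Int.isUnit_iff] at this

lemma Rat.sq_add_sq_div_five_sub_ne (p q : ℚ) :
    (p ^ 2 + q ^ 2) / 5 - p ^ 2 * q ^ 2 / 3 ≠ 1 / 7 := by
  intro h
  have hp : IsCoprime p.num (p.den : ℤ) := p.isCoprime_num_den
  have hq : IsCoprime q.num (q.den : ℤ) := q.isCoprime_num_den
  have hp0 : (p.den : ℚ) ≠ 0 := by exact_mod_cast p.den_ne_zero
  have hq0 : (q.den : ℚ) ≠ 0 := by exact_mod_cast q.den_ne_zero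
  have key : 21 * (p.num ^ 2 * (q.den : ℤ) ^ 2 + q.num ^ 2 * (p.den : ℤ) ^ 2)
      - 35 * p.num ^ 2 * q.num ^ 2 = 15 * (p.den : ℤ) ^ 2 * (q.den : ℤ) ^ 2 := by
    rw [← Rat.num_div_den p, ← Rat.num_div_den q] at h
    field_simp at h
    have : (21 * (p.num ^ 2 * (q.den : ℚ) ^ 2 + q.num ^ 2 * (p.den : ℚ) ^ 2)
      - 35 * p.num ^ 2 * q.num ^ 2 : ℚ) = 15 * (p.den : ℚ) ^ 2 * (q.den : ℚ) ^ 2 := by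
      linarith
    exact_mod_cast this
  have hdvd : (3 : ℤ) ∣ p.num ^ 2 * q.num ^ 2 :=
    ⟨12 * p.num ^ 2 * q.num ^ 2 - 7 * (p.num ^ 2 * (q.den : ℤ) ^ 2 + q.num ^ 2 * (p.den : ℤ) ^ 2)
      + 5 * (p.den : ℤ) ^ 2 * (q.den : ℤ) ^ 2, by linarith⟩
  rcases Int.prime_three.dvd_or_dvd hdvd with h3 | h3
  · exact sq_fractions_ne_of_three_dvd hp hq (Int.prime_three.dvd_of_dvd_pow h3) key
  · exact sq_fractions_ne_of_three_dvd hq hp (Int.prime_three.dvd_of_dvd_pow h3) (by linarith)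

/-- The weights of the symmetric five-node rule of degree at least five. -/
lemma symmetric_rule_weights_iff {x y : ℝ} (hx : x ≠ 0) (hy : y ≠ 0) (hxy : x - y ≠ 0)
    (a b c : ℝ) :
    (a + b + c = 1 ∧ b * x + c * y = 1 / 3 ∧ b * x ^ 2 + c * y ^ 2 = 1 / 5) ↔
    a = 1 - (1 / 5 - y / 3) / (x * (x - y)) + (1 / 5 - x / 3) / (y * (x - y)) ∧
      b = (1 / 5 - y / 3) / (x * (x - y)) ∧ c = -((1 / 5 - x / 3) / (y * (x - y))) := by
  constructor
  · rintro ⟨h0, h2, h4⟩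
    have hb : b = (1 / 5 - y / 3) / (x * (x - y)) := by
      rw [eq_div_iff (mul_ne_zero hx hxy)]
      linear_combination h4 - y * h2
    have hc : c = -((1 / 5 - x / 3) / (y * (x - y))) := by
      rw [← neg_div, eq_div_iff (mul_ne_zero hy hxy)]
      linear_combination x * h2 - h4
    exact ⟨by rw [← hb]; linarith, hb, hc⟩
  · rintro ⟨rfl, rfl, rfl⟩
    refine ⟨by ring, ?_, ?_⟩ <;> field_simp <;> ring


/-- For distinct rational nodes t₁, t₂ ∈ (0,1) there is a unique
triple (a₀,a₁,a₂) making W(g) = 2a₀g(0) + a₁(g(−t₁)+g(t₁)) + a₂(g(−t₂)+g(t₂))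
exact on φ_j for j = 0,…,5; the triple sums to 1, consists of rationals, and
W(φ₆) ≠ 2/7 = I(φ₆), so W has degree exactly 5. -/
theorem combined_rule_k2_degree_five
    (t1 t2 : ℚ) (hne : t1 ≠ t2)
    (h01 : 0 < t1) (h11 : t1 < 1) (h02 : 0 < t2) (h12 : t2 < 1) :
    (∃! abc : ℝ × ℝ × ℝ,
      ∀ j : ℕ, j ≤ 5 →
        2 * abc.1 * (0:ℝ) ^ j +
          abc.2.1 * ((-(t1 : ℝ)) ^ j + (t1 : ℝ) ^ j) +
          abc.2.2 * ((-(t2 : ℝ)) ^ j + (t2 : ℝ) ^ j)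
          = ∫ x in (-1:ℝ)..1, x ^ j) ∧
    (∀ abc : ℝ × ℝ × ℝ,
      (∀ j : ℕ, j ≤ 5 →
        2 * abc.1 * (0:ℝ) ^ j +
          abc.2.1 * ((-(t1 : ℝ)) ^ j + (t1 : ℝ) ^ j) +
          abc.2.2 * ((-(t2 : ℝ)) ^ j + (t2 : ℝ) ^ j)
          = ∫ x in (-1:ℝ)..1, x ^ j) →
      abc.1 + abc.2.1 + abc.2.2 = 1 ∧
      (∃ q : ℚ, abc.1 = (q : ℝ)) ∧ (∃ q : ℚ, abc.2.1 = (q : ℝ)) ∧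
      (∃ q : ℚ, abc.2.2 = (q : ℝ)) ∧
      2 * abc.1 * (0:ℝ) ^ 6 +
          abc.2.1 * ((-(t1 : ℝ)) ^ 6 + (t1 : ℝ) ^ 6) +
          abc.2.2 * ((-(t2 : ℝ)) ^ 6 + (t2 : ℝ) ^ 6) ≠ 2 / 7) ∧
    (∫ x in (-1:ℝ)..1, x ^ 6) = (2 / 7 : ℝ) := by
  have hx : (t1 : ℝ) ^ 2 ≠ 0 := by positivity
  have hy : (t2 : ℝ) ^ 2 ≠ 0 := by positivity
  have hxy : (t1 : ℝ) ^ 2 - (t2 : ℝ) ^ 2 ≠ 0 := by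
    have : t1 ^ 2 ≠ t2 ^ 2 := fun h ↦ hne ((sq_eq_sq₀ h01.le h02.le).mp h)
    exact sub_ne_zero.mpr (by exact_mod_cast this)
  simp only [symmetric_rule_exact_iff]
  have weights := symmetric_rule_weights_iff hx hy hxy
  simp only [← pow_mul, Nat.reduceMul] at weights
  refine ⟨⟨(_, _, _), (weights _ _ _).mpr ⟨rfl, rfl, rfl⟩, ?_⟩, ?_, ?_⟩
  · rintro ⟨a, b, c⟩ h
    obtain ⟨ha, hb, hc⟩ := (weights a b c).mp h
    exact Prod.ext ha (Prod.ext hb hc)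
  · rintro ⟨a, b, c⟩ h
    obtain ⟨ha, hb, hc⟩ := (weights a b c).mp h
    refine ⟨h.1, ⟨1 - (1 / 5 - t2 ^ 2 / 3) / (t1 ^ 2 * (t1 ^ 2 - t2 ^ 2)) +
        (1 / 5 - t1 ^ 2 / 3) / (t2 ^ 2 * (t1 ^ 2 - t2 ^ 2)), by push_cast; exact ha⟩,
      ⟨(1 / 5 - t2 ^ 2 / 3) / (t1 ^ 2 * (t1 ^ 2 - t2 ^ 2)), by push_cast; exact hb⟩,
      ⟨-((1 / 5 - t1 ^ 2 / 3) / (t2 ^ 2 * (t1 ^ 2 - t2 ^ 2))), by push_cast; exact hc⟩, ?_⟩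
    intro h6
    dsimp only at h h6
    have hdeg : ((t1 : ℝ) ^ 2 + (t2 : ℝ) ^ 2) / 5 - (t1 : ℝ) ^ 2 * (t2 : ℝ) ^ 2 / 3 = 1 / 7 := by
      linear_combination h6 / 2 - ((t1 : ℝ) ^ 2 + (t2 : ℝ) ^ 2) * h.2.2 +
        (t1 : ℝ) ^ 2 * (t2 : ℝ) ^ 2 * h.2.1
    exact Rat.sq_add_sq_div_five_sub_ne t1 t2 (Rat.cast_injective (α := ℝ) (by push_cast; exact hdeg))
  · rw [integral_pow]
    norm_num
end

section
/- Let A(g) = g(−√3/3) + g(√3/3) and let S(g) = (1/3)·(g(−1) + 4·g(0) + g(1)) be Simpson's rule. Then: (a) A(φ_j) = S(φ_j) = I(φ_j) for j = 0, 1, 2, 3, with I(φ_4) − A(φ_4) = 8/45 > 0 and I(φ_4) − S(φ_4) = −4/15 < 0, so A and S are companion rules of degree 3; (b) the combined rule Y(g) = (3·A(g) + 2·S(g))/5 equals (1/15)·(2·g(−1) + 9·g(−√3/3) + 8·g(0) + 9·g(√3/3) + 2·g(1)) for every g; (c) Y(φ_j) = I(φ_j) for j = 0, 1, 2, 3, 4,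 5 while Y(φ_6) = 14/45 ≠ 2/7 = I(φ_6), so Y has degree exactly 5. -/
/-- (a) The two-point rule A(g) = g(−√3/3) + g(√3/3) and
Simpson's rule S are exact on φ_j for j = 0,…,3 with errors 8/45 > 0 and
−4/15 < 0 at φ₄ (companion rules of degree 3); (b) the combined rule
Y = (3A + 2S)/5 equals (1/15)(2g(−1) + 9g(−√3/3) + 8g(0) + 9g(√3/3) + 2g(1));
(c) Y is exact on φ_j for j = 0,…,5 while Y(φ₆) = 14/45 ≠ 2/7 = I(φ₆),
so Y has degree exactly 5. -/
theorem two_point_simpson_combined_degree_five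
    (A S Y : (ℝ → ℝ) → ℝ)
    (hA : ∀ g : ℝ → ℝ, A g = g (-(Real.sqrt 3) / 3) + g (Real.sqrt 3 / 3))
    (hS : ∀ g : ℝ → ℝ, S g = 1 / 3 * (g (-1) + 4 * g 0 + g 1))
    (hY : ∀ g : ℝ → ℝ, Y g = (3 * A g + 2 * S g) / 5) :
    -- (a)
    (∀ j : ℕ, j ≤ 3 → A (fun t => t ^ j) = ∫ x in (-1:ℝ)..1, x ^ j) ∧
    (∀ j : ℕ, j ≤ 3 → S (fun t => t ^ j) = ∫ x in (-1:ℝ)..1, x ^ j) ∧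
    (∫ x in (-1:ℝ)..1, x ^ 4) - A (fun t => t ^ 4) = 8 / 45 ∧
    0 < (∫ x in (-1:ℝ)..1, x ^ 4) - A (fun t => t ^ 4) ∧
    (∫ x in (-1:ℝ)..1, x ^ 4) - S (fun t => t ^ 4) = -(4 / 15) ∧
    (∫ x in (-1:ℝ)..1, x ^ 4) - S (fun t => t ^ 4) < 0 ∧
    -- (b)
    (∀ g : ℝ → ℝ,
      Y g = 1 / 15 * (2 * g (-1) + 9 * g (-(Real.sqrt 3) / 3) + 8 * g 0 +
                      9 * g (Real.sqrt 3 / 3) + 2 * g 1)) ∧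
    -- (c)
    (∀ j : ℕ, j ≤ 5 → Y (fun t => t ^ j) = ∫ x in (-1:ℝ)..1, x ^ j) ∧
    Y (fun t => t ^ 6) = 14 / 45 ∧
    (∫ x in (-1:ℝ)..1, x ^ 6) = (2 / 7 : ℝ) ∧
    Y (fun t => t ^ 6) ≠ ∫ x in (-1:ℝ)..1, x ^ 6 := by
  have node_sq : (√3 / 3) ^ 2 = 1 / 3 := by
    rw [div_pow, Real.sq_sqrt (by norm_num)]
    norm_num
  have A_pow (j : ℕ) : A (fun t => t ^ j) = (-(√3 / 3)) ^ j + (√3 / 3) ^ j := by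
    rw [hA, neg_div]
  have A_four : A (fun t => t ^ 4) = 2 / 9 := by
    rw [A_pow]
    linear_combination 2 * ((√3 / 3) ^ 2 + 1 / 3) * node_sq
  have A_six : A (fun t => t ^ 6) = 2 / 27 := by
    rw [A_pow]
    linear_combination 2 * ((√3 / 3) ^ 4 + (√3 / 3) ^ 2 / 3 + 1 / 9) * node_sq
  have A_exact (j : ℕ) (hj : j ≤ 3) : A (fun t => t ^ j) = ∫ x in (-1:ℝ)..1, x ^ j := by
    rw [A_pow, integral_pow]
    interval_cases j
    · norm_num
    · norm_num
    · norm_num [node_sq]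
    · norm_num [Odd.neg_pow (by decide : Odd 3)]
  have S_exact (j : ℕ) (hj : j ≤ 3) : S (fun t => t ^ j) = ∫ x in (-1:ℝ)..1, x ^ j := by
    rw [hS, integral_pow]
    interval_cases j <;> norm_num
  have Y_exact (j : ℕ) (hj : j ≤ 5) : Y (fun t => t ^ j) = ∫ x in (-1:ℝ)..1, x ^ j := by
    obtain hj3 | rfl | rfl : j ≤ 3 ∨ j = 4 ∨ j = 5 := by omega
    · rw [hY, A_exact j hj3, S_exact j hj3]
      ring
    · rw [hY, A_four, hS, integral_pow]
      norm_num
    · rw [hY, A_pow, Odd.neg_pow (by decide), hS, integral_pow]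
      norm_num
  have S_four : S (fun t => t ^ 4) = 2 / 3 := by
    rw [hS]
    norm_num
  have I_four : ∫ x in (-1:ℝ)..1, x ^ 4 = 2 / 5 := by
    rw [integral_pow]
    norm_num
  have I_six : ∫ x in (-1:ℝ)..1, x ^ 6 = 2 / 7 := by
    rw [integral_pow]
    norm_num
  have Y_six : Y (fun t => t ^ 6) = 14 / 45 := by
    rw [hY, A_six, hS]
    norm_num
  rw [I_four, A_four, S_four, I_six, Y_six]
  refine ⟨A_exact, S_exact, by norm_num, by norm_num, by norm_num, by norm_num, ?_, Y_exact,
    rfl, rfl, by norm_num⟩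
  intro g
  rw [hY, hA, hS]
  ring
end

section
/- The seven-point rule W̃(g) = (1/630)·(54·g(−1) + 416·g(0) + 54·g(1) + 125·g(−√(3/5)) + 125·g(√(3/5)) + 243·g(−√3/3) + 243·g(√3/3)) satisfies W̃(φ_j) = I(φ_j) for j = 0, 1, …, 7, while I(φ_8) − W̃(φ_8) = −16/1575 < 0; hence W̃ has degree exactly 7 and is a negative rule. -/
/-- The seven-point rule
W̃(g) = (1/630)(54g(−1) + 416g(0) + 54g(1) + 125g(−√(3/5)) + 125g(√(3/5))
+ 243g(−√3/3) + 243g(√3/3)) is exact on φ_j for j = 0,…,7, and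
I(φ₈) − W̃(φ₈) = −16/1575 < 0; hence W̃ has degree exactly 7 and is negative. -/
theorem seven_point_rule_degree_seven_negative
    (W : (ℝ → ℝ) → ℝ)
    (hW : ∀ g : ℝ → ℝ,
      W g = 1 / 630 * (54 * g (-1) + 416 * g 0 + 54 * g 1 +
        125 * g (-Real.sqrt (3 / 5)) + 125 * g (Real.sqrt (3 / 5)) +
        243 * g (-(Real.sqrt 3) / 3) + 243 * g (Real.sqrt 3 / 3))) :
    (∀ j : ℕ, j ≤ 7 → W (fun t => t ^ j) = ∫ x in (-1:ℝ)..1, x ^ j) ∧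
    (∫ x in (-1:ℝ)..1, x ^ 8) - W (fun t => t ^ 8) = -(16 / 1575) ∧
    (∫ x in (-1:ℝ)..1, x ^ 8) - W (fun t => t ^ 8) < 0 := by
  have ha : Real.sqrt (3 / 5) ^ 2 = 3 / 5 := Real.sq_sqrt (by norm_num)
  have hb : Real.sqrt 3 ^ 2 = 3 := Real.sq_sqrt (by norm_num)
  generalize Real.sqrt (3 / 5) = a at *
  generalize Real.sqrt 3 = b at *
  have ha4 : a ^ 4 = 9 / 25 := by rw [show a ^ 4 = (a ^ 2) ^ 2 by ring, ha]; norm_num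
  have hb4 : b ^ 4 = 9 := by rw [show b ^ 4 = (b ^ 2) ^ 2 by ring, hb]; norm_num
  have ha6 : a ^ 6 = 27 / 125 := by rw [show a ^ 6 = (a ^ 2) ^ 3 by ring, ha]; norm_num
  have hb6 : b ^ 6 = 27 := by rw [show b ^ 6 = (b ^ 2) ^ 3 by ring, hb]; norm_num
  have ha8 : a ^ 8 = 81 / 625 := by rw [show a ^ 8 = (a ^ 2) ^ 4 by ring, ha]; norm_num
  have hb8 : b ^ 8 = 81 := by rw [show b ^ 8 = (b ^ 2) ^ 4 by ring, hb]; norm_num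
  have error_eq : (∫ x in (-1:ℝ)..1, x ^ 8) - W (fun t => t ^ 8) = -(16 / 1575) := by
    rw [hW, integral_pow]
    ring_nf
    rw [ha8, hb8]
    norm_num
  refine ⟨fun j hj => ?_, error_eq, by rw [error_eq]; norm_num⟩
  rw [hW, integral_pow]
  interval_cases j <;> ring_nf <;> simp only [ha, hb, ha4, hb4, ha6, hb6] <;> norm_num
end

section
/- Consider the degree-one rules Q_0(g) = 2·g(0), Q_1(g) = g(−1/2) + g(1/2), Q_2(g) = g(−1/3) + g(1/3), Q_3(g) = g(−1/4) + g(1/4), and the combined rule W_3(g) = (−4426/105)·Q_0(g) + (5344/315)·Q_1(g) − (5589/49)·Q_2(g) + (309248/2205)·Q_3(g). Then: (a) the four coefficients sum to 1; (b) they are the unique reals a_0, a_1, a_2, a_3 for which a_0·Q_0 + a_1·Q_1 + a_2·Q_2 + a_3·Q_3 is exact for φ_j with 0 ≤ j ≤ 7; (c) W_3(φ_j) = I(φ_j) for j = 0, 1, …, 7 while I(φ_8) − W_3(φ_8) = 1817/15120 > 0, so W_3 has degree exactly 7 and is a positive rule. -/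
/-- With Q₀(g) = 2g(0), Q₁(g) = g(−1/2)+g(1/2),
Q₂(g) = g(−1/3)+g(1/3), Q₃(g) = g(−1/4)+g(1/4) and
W₃ = (−4426/105)Q₀ + (5344/315)Q₁ − (5589/49)Q₂ + (309248/2205)Q₃:
(a) the four coefficients sum to 1; (b) they are the unique reals making the
combination exact on φ_j for 0 ≤ j ≤ 7; (c) W₃ is exact on φ_j for
j = 0,…,7 while I(φ₈) − W₃(φ₈) = 1817/15120 > 0, so W₃ has degree exactly 7
and is positive. -/
theorem combined_open_rule_degree_seven
    (Q0 Q1 Q2 Q3 W3 : (ℝ → ℝ) → ℝ)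
    (hQ0 : ∀ g : ℝ → ℝ, Q0 g = 2 * g 0)
    (hQ1 : ∀ g : ℝ → ℝ, Q1 g = g (-(1/2)) + g (1/2))
    (hQ2 : ∀ g : ℝ → ℝ, Q2 g = g (-(1/3)) + g (1/3))
    (hQ3 : ∀ g : ℝ → ℝ, Q3 g = g (-(1/4)) + g (1/4))
    (hW3 : ∀ g : ℝ → ℝ,
      W3 g = (-4426/105) * Q0 g + (5344/315) * Q1 g
             - (5589/49) * Q2 g + (309248/2205) * Q3 g) :
    -- (a)
    ((-4426/105 : ℝ) + 5344/315 + (-(5589/49)) + 309248/2205 = 1) ∧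
    -- (b)
    (∀ a0 a1 a2 a3 : ℝ,
      (∀ j : ℕ, j ≤ 7 →
        a0 * Q0 (fun t => t ^ j) + a1 * Q1 (fun t => t ^ j) +
          a2 * Q2 (fun t => t ^ j) + a3 * Q3 (fun t => t ^ j)
          = ∫ x in (-1:ℝ)..1, x ^ j) ↔
      (a0 = -4426/105 ∧ a1 = 5344/315 ∧ a2 = -(5589/49) ∧
       a3 = 309248/2205)) ∧
    -- (c)
    (∀ j : ℕ, j ≤ 7 → W3 (fun t => t ^ j) = ∫ x in (-1:ℝ)..1, x ^ j) ∧
    (∫ x in (-1:ℝ)..1, x ^ 8) - W3 (fun t => t ^ 8) = 1817 / 15120 ∧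
    0 < (∫ x in (-1:ℝ)..1, x ^ 8) - W3 (fun t => t ^ 8) := by
  simp only [hW3, hQ0, hQ1, hQ2, hQ3, integral_pow]
  refine ⟨by norm_num, fun a0 a1 a2 a3 => ⟨fun h => ?_, ?_⟩, ?_, by norm_num, by norm_num⟩
  · have h0 := h 0 (by norm_num)
    have h2 := h 2 (by norm_num)
    have h4 := h 4 (by norm_num)
    have h6 := h 6 (by norm_num)
    norm_num at h0 h2 h4 h6
    refine ⟨?_, ?_, ?_, ?_⟩ <;> linarith
  · rintro ⟨rfl, rfl, rfl, rfl⟩ j hj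
    interval_cases j <;> norm_num
  · intro j hj
    interval_cases j <;> norm_num
end
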